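/- arXiv:2506.00532 — 18 statements merged into one kernel-verified Lean document; each statement's English description precedes it below -/
import Mathlib

section
/- The optimal pre-GenAI worker knowledge level x₀* = (k+2w)·t_c/(2k) satisfies 0 < x₀* < 1, and x₀* is the unique maximizer of Π₀ over the interval [0,1]; moreover the maximal profit equals Π₀* = ([2k−(k+2w)t_c]² + 4k(2−k−2w))/(8k). -/
/-- The optimal pre-GenAI worker knowledge level
`x₀* = (k+2w)·t_c/(2k)` satisfies `0 < x₀* < 1`, is the unique maximizer of
`P0` over `[0,1]`, and the maximal profit equals
`([2k−(k+2w)t_c]² + 4k(2−k−2w))/(8k)`. -/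
theorem stmt_0 (k w tc : ℝ) (hk : 0 < k) (hw : 0 < w)
    (htc : 0 < tc) (htc' : tc < 2 * k / (k + 2 * w)) :
    let P0 : ℝ → ℝ := fun x => 1 - (w + k * x ^ 2 / 2) - (w + k / 2) * (1 - x) * tc
    let x₀ : ℝ := (k + 2 * w) * tc / (2 * k)
    0 < x₀ ∧ x₀ < 1 ∧
      IsMaxOn P0 (Set.Icc (0 : ℝ) 1) x₀ ∧
      (∀ x ∈ Set.Icc (0 : ℝ) 1, P0 x = P0 x₀ → x = x₀) ∧
      P0 x₀ = ((2 * k - (k + 2 * w) * tc) ^ 2 + 4 * k * (2 - k - 2 * w)) / (8 * k) := by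
  intro P0 x₀
  have hkw : 0 < k + 2 * w := by positivity
  have hx₀ : 2 * k * x₀ = (k + 2 * w) * tc := by
    simp only [x₀]
    field_simp
  have complete_square (x : ℝ) : P0 x = P0 x₀ - k / 2 * (x - x₀) ^ 2 := by
    simp only [P0]
    linear_combination (x₀ - x) / 2 * hx₀
  refine ⟨by positivity, ?_, fun x _ => ?_, fun x _ h => ?_, ?_⟩
  · rw [lt_div_iff₀ hkw] at htc'
    rw [div_lt_one (by positivity)]
    linarith
  · rw [Set.mem_ofPred_eq, complete_square x]
    have : 0 ≤ k / 2 * (x - x₀) ^ 2 := by positivity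
    linarith
  · rw [complete_square x, sub_eq_self, mul_eq_zero] at h
    exact sub_eq_zero.mp (pow_eq_zero_iff two_ne_zero |>.mp (h.resolve_left (by positivity)))
  · simp only [P0, x₀]
    field_simp
    ring
end

section
/- Suppose r_t ≤ x₀*. If h < (1 − t_v)/t_r, then the supremum of Π_t over [r_t, 1] strictly exceeds the supremum of Π₀ over [0,1] (adoption of worker-level automation is profitable); if instead h ≥ (1 − t_v)/t_r, then the supremum of Π_t over [r_t, 1] is at most the supremum of Π₀ over [0,1]. -/
/-- Suppose `r_t ≤ x₀*`. If `h < (1 − t_v)/t_r`, adoption of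
worker-level automation is profitable (the supremum of `Π_t` over `[r_t,1]`
strictly exceeds the supremum of `Π₀` over `[0,1]`); if instead
`h ≥ (1 − t_v)/t_r`, it is not. -/
theorem stmt_1 (k w tc rt h tv tr : ℝ)
    (hk : 0 < k) (hw : 0 < w) (htc : 0 < tc) (htc' : tc < 2 * k / (k + 2 * w))
    (hrt : rt ∈ Set.Ioo (0 : ℝ) 1) (hh : h ∈ Set.Ioo (0 : ℝ) 1)
    (htv : tv ∈ Set.Ioo (0 : ℝ) 1) (htr : tr ∈ Set.Ioo (0 : ℝ) 1)
    (hvr : 1 < tv + tr)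
    (hle : rt ≤ (k + 2 * w) * tc / (2 * k)) :
    let P0 : ℝ → ℝ := fun x => 1 - (w + k * x ^ 2 / 2) - (w + k / 2) * (1 - x) * tc
    let Pt : ℝ → ℝ := fun x =>
      1 - (w + k * x ^ 2 / 2) * ((1 - rt) + (tv + h * tr) * rt)
        - (w + k / 2) * (1 - x) * tc
    (h < (1 - tv) / tr →
      sSup (Pt '' Set.Icc rt 1) > sSup (P0 '' Set.Icc 0 1)) ∧
    ((1 - tv) / tr ≤ h →
      sSup (Pt '' Set.Icc rt 1) ≤ sSup (P0 '' Set.Icc 0 1)) := by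
  obtain ⟨hr0, hr1⟩ := hrt
  obtain ⟨htr0, -⟩ := htr
  intro P0 Pt
  set x₀ : ℝ := (k + 2 * w) * tc / (2 * k) with hx₀
  have hx₀1 : x₀ < 1 := by
    rw [lt_div_iff₀ (by positivity)] at htc'
    rw [hx₀, div_lt_one (by positivity)]
    linarith
  have hvertex : (w + k / 2) * tc = k * x₀ := by
    rw [hx₀]
    field_simp
    ring
  have hgain (x : ℝ) : Pt x = P0 x + (w + k * x ^ 2 / 2) * (rt * (1 - tv - h * tr)) := by
    simp only [P0, Pt]
    ring
  have hcost (x : ℝ) : 0 < w + k * x ^ 2 / 2 := by positivity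
  have hmax (x : ℝ) : P0 x ≤ P0 x₀ := by
    have hsq : P0 x₀ - P0 x = k / 2 * (x - x₀) ^ 2 := by
      simp only [P0]
      linear_combination (x₀ - x) * hvertex
    have : 0 ≤ k / 2 * (x - x₀) ^ 2 := by positivity
    linarith
  constructor
  · intro hlt
    rw [lt_div_iff₀ htr0] at hlt
    have hbdd : BddAbove (Pt '' Set.Icc rt 1) :=
      isCompact_Icc.bddAbove_image (by fun_prop)
    have hPt : Pt x₀ ≤ sSup (Pt '' Set.Icc rt 1) :=
      le_csSup hbdd (Set.mem_image_of_mem Pt ⟨hle, hx₀1.le⟩)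
    have hP0 : sSup (P0 '' Set.Icc 0 1) ≤ P0 x₀ :=
      csSup_le ((Set.nonempty_Icc.2 zero_le_one).image P0)
        (Set.forall_mem_image.2 fun x _ => hmax x)
    have hpos : 0 < (w + k * x₀ ^ 2 / 2) * (rt * (1 - tv - h * tr)) :=
      mul_pos (hcost x₀) (mul_pos hr0 (by linarith))
    linarith [hgain x₀]
  · intro hge
    rw [div_le_iff₀ htr0] at hge
    have hbdd : BddAbove (P0 '' Set.Icc 0 1) :=
      ⟨P0 x₀, Set.forall_mem_image.2 fun x _ => hmax x⟩
    refine csSup_le ((Set.nonempty_Icc.2 hr1.le).image Pt) (Set.forall_mem_image.2 fun x hx => ?_)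
    have hP0 : P0 x ≤ sSup (P0 '' Set.Icc 0 1) :=
      le_csSup hbdd (Set.mem_image_of_mem P0 ⟨hr0.le.trans hx.1, hx.2⟩)
    have hnonpos : (w + k * x ^ 2 / 2) * (rt * (1 - tv - h * tr)) ≤ 0 :=
      mul_nonpos_of_nonneg_of_nonpos (hcost x).le
        (mul_nonpos_of_nonneg_of_nonpos hr0.le (by linarith))
    linarith [hgain x]
end

section
/- Assume t_v + h·t_r < 1. Let D = (1 − r_t) + (t_v + h·t_r)·r_t, x_t = x₀*/D, and x_t* = max{r_t, min{1, x_t}}. Then x_t* maximizes Π_t over [r_t, 1], and x_t* > x₀*. Moreover, viewed as a function of the parameters, x_t* is nondecreasing in r_t and nonincreasing in h. -/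
/-- The clamp of `t` to `[r, 1]` satisfies the variational inequality of the projection. -/
theorem clamp_variational {r t x : ℝ} (hrx : r ≤ x) (hx : x ≤ 1) :
    0 ≤ (x - max r (min 1 t)) * (max r (min 1 t) - t) := by
  rcases le_total t r with htr | hrt
  · rw [min_eq_right (htr.trans (hrx.trans hx)), max_eq_left htr]
    exact mul_nonneg (by linarith) (by linarith)
  · rcases le_total t 1 with ht | ht
    · rw [min_eq_right ht, max_eq_right hrt]
      simp
    · rw [min_eq_left ht, max_eq_right (hrx.trans hx)]
      exact mul_nonneg_of_nonpos_of_nonpos (by linarith) (by linarith)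

theorem unit_cost_pos {r c : ℝ} (hr : r < 1) (hr0 : 0 < r) (hc : 0 < c) :
    0 < (1 - r) + c * r := by
  have := mul_pos hc hr0
  linarith


/-- Assume `t_v + h·t_r < 1`. With `D = (1−r_t)+(t_v+h·t_r)·r_t`,
`x_t = x₀*/D` and `x_t* = max{r_t, min{1, x_t}}`, the point `x_t*` maximizes
`Π_t` over `[r_t, 1]` and `x_t* > x₀*`; moreover, as a function of the
parameters, `x_t*` is nondecreasing in `r_t` and nonincreasing in `h`. -/
theorem stmt_2 (k w tc rt h tv tr : ℝ)
    (hk : 0 < k) (hw : 0 < w) (htc : 0 < tc) (htc' : tc < 2 * k / (k + 2 * w))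
    (hrt : rt ∈ Set.Ioo (0 : ℝ) 1) (hh : h ∈ Set.Ioo (0 : ℝ) 1)
    (htv : tv ∈ Set.Ioo (0 : ℝ) 1) (htr : tr ∈ Set.Ioo (0 : ℝ) 1)
    (hvr : 1 < tv + tr)
    (hlt : tv + h * tr < 1) :
    let x0 : ℝ := (k + 2 * w) * tc / (2 * k)
    let D : ℝ := (1 - rt) + (tv + h * tr) * rt
    let xt : ℝ := x0 / D
    let xts : ℝ := max rt (min 1 xt)
    let Pt : ℝ → ℝ := fun x =>
      1 - (w + k * x ^ 2 / 2) * ((1 - rt) + (tv + h * tr) * rt)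
        - (w + k / 2) * (1 - x) * tc
    IsMaxOn Pt (Set.Icc rt 1) xts ∧
    x0 < xts ∧
    (∀ r r' : ℝ, 0 < r → r ≤ r' → r' < 1 →
      max r (min 1 (x0 / ((1 - r) + (tv + h * tr) * r))) ≤
        max r' (min 1 (x0 / ((1 - r') + (tv + h * tr) * r')))) ∧
    (∀ h₁ h₂ : ℝ, 0 < h₁ → h₁ ≤ h₂ → tv + h₂ * tr < 1 →
      max rt (min 1 (x0 / ((1 - rt) + (tv + h₂ * tr) * rt))) ≤
        max rt (min 1 (x0 / ((1 - rt) + (tv + h₁ * tr) * rt)))) := by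
  obtain ⟨hrt0, hrt1⟩ := hrt
  have hc : 0 < tv + h * tr := add_pos htv.1 (mul_pos hh.1 htr.1)
  intro x0 D xt xts Pt
  have hD : 0 < D := unit_cost_pos hrt1 hrt0 hc
  have hD1 : D < 1 := by
    have : (tv + h * tr) * rt < 1 * rt := mul_lt_mul_of_pos_right hlt hrt0
    simp only [D]
    linarith
  have hx0 : 0 < x0 := by positivity
  have hx1 : x0 < 1 := by
    rw [lt_div_iff₀ (by positivity)] at htc'
    rw [div_lt_one (by positivity)]
    linarith
  refine ⟨fun x hx => ?_, ?_, fun r r' hr hrr' hr' => ?_, fun h₁ h₂ hh₁ hh₁₂ _ => ?_⟩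
  · have hproj : 0 ≤ (x - xts) * (xts - xt) := clamp_variational hx.1 hx.2
    have hfoc : (w + k / 2) * tc = k * (D * xt) := by
      simp only [xt, x0]
      field_simp
      ring
    have hdiff : Pt xts - Pt x =
        k * D * ((x - xts) * (xts - xt)) + k * D * (x - xts) ^ 2 / 2 := by
      change (1 - (w + k * xts ^ 2 / 2) * D - (w + k / 2) * (1 - xts) * tc)
        - (1 - (w + k * x ^ 2 / 2) * D - (w + k / 2) * (1 - x) * tc) = _
      linear_combination (xts - x) * hfoc
    have : 0 ≤ Pt xts - Pt x := by
      rw [hdiff]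
      positivity
    exact sub_nonneg.mp this
  · exact lt_max_of_lt_right (lt_min hx1 ((lt_div_iff₀ hD).mpr (mul_lt_of_lt_one_right hx0 hD1)))
  · have hpos := unit_cost_pos hr' (hr.trans_le hrr') hc
    have hle : (1 - r') + (tv + h * tr) * r' ≤ (1 - r) + (tv + h * tr) * r := by
      nlinarith
    gcongr
  · have htr0 := htr.1
    have hpos := unit_cost_pos hrt1 hrt0 (add_pos htv.1 (mul_pos hh₁ htr0))
    gcongr
end

section
/- Assume t_v + h·t_r < 1. Define h₀ = ((k+2w)·t_c − 2k·t_v)/(2k·t_r) and r₀ = (2k − (k+2w)·t_c)/(2k·(1 − t_v − h·t_r)). If h < h₀ and r₀ ≤ r_t < 1, then x = 1 is the unique maximizer of Π_t over [r_t, 1]; that is, the two-layer hierarchy collapses into a single layer of workers with complete knowledge. -/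
/-- Assume `t_v + h·t_r < 1`. If `h < h₀` and `r₀ ≤ r_t < 1`,
then `x = 1` is the unique maximizer of `Π_t` over `[r_t, 1]` (the two-layer
hierarchy collapses into a single layer of workers with complete knowledge). -/
theorem stmt_3 (k w tc rt h tv tr : ℝ)
    (hk : 0 < k) (hw : 0 < w) (htc : 0 < tc) (htc' : tc < 2 * k / (k + 2 * w))
    (hrt : rt ∈ Set.Ioo (0 : ℝ) 1) (hh : h ∈ Set.Ioo (0 : ℝ) 1)
    (htv : tv ∈ Set.Ioo (0 : ℝ) 1) (htr : tr ∈ Set.Ioo (0 : ℝ) 1)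
    (hvr : 1 < tv + tr)
    (hlt : tv + h * tr < 1)
    (hh0 : h < ((k + 2 * w) * tc - 2 * k * tv) / (2 * k * tr))
    (hr0 : (2 * k - (k + 2 * w) * tc) / (2 * k * (1 - tv - h * tr)) ≤ rt) :
    let Pt : ℝ → ℝ := fun x =>
      1 - (w + k * x ^ 2 / 2) * ((1 - rt) + (tv + h * tr) * rt)
        - (w + k / 2) * (1 - x) * tc
    IsMaxOn Pt (Set.Icc rt 1) 1 ∧
    (∀ x ∈ Set.Icc rt (1 : ℝ), Pt x = Pt 1 → x = 1) := by
  intro Pt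
  obtain ⟨hrt0, hrt1⟩ := hrt
  have hgap : 0 < 1 - tv - h * tr := by linarith
  have hcost : 0 < 1 - rt * (1 - tv - h * tr) := by
    nlinarith [mul_pos hh.1 htr.1, htv.1]
  rw [div_le_iff₀ (by positivity)] at hr0
  have key : ∀ x ∈ Set.Icc rt (1 : ℝ), x ≠ 1 → Pt x < Pt 1 := by
    intro x hx hne
    have hx1 : 0 < 1 - x := sub_pos.mpr (lt_of_le_of_ne hx.2 hne)
    have hslope : 0 < (k + 2 * w) * tc - k * (1 + x) * (1 - rt * (1 - tv - h * tr)) := by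
      nlinarith [mul_pos (mul_pos hk hcost) hx1]
    have hdiff : Pt 1 - Pt x = (1 - x) / 2 *
        ((k + 2 * w) * tc - k * (1 + x) * (1 - rt * (1 - tv - h * tr))) := by
      simp only [Pt]
      ring
    have hpos := mul_pos (half_pos hx1) hslope
    linarith
  refine ⟨fun x hx => ?_, fun x hx heq => ?_⟩
  · rcases eq_or_ne x 1 with rfl | hne
    · exact le_refl (Pt 1)
    · exact (key x hx hne).le
  · by_contra hne
    exact (key x hx hne).ne heq
end

section
/- Assume t_v + h·t_r < 1 and t_c < k/(k+2w). Define the span-of-control function s(r) = 2k·[1 − r + r·(t_v + h·t_r)]² / (t_c·[2k − (k+2w)·t_c − 2k·(1 − t_v − h·t_r)·r]), r₁ₐ = (k − (k+2w)·t_c)/(k·(1 − t_v − h·t_r)), and r₀ = (2k − (k+2w)·t_c)/(2k·(1 − t_v − h·t_r)). Then 0 < r₁ₐ < r₀, the denominator of s is strictly positive for all r ∈ (0, r₀), and s is strictly decreasing on (0, r₁ₐ) and strictly increasing on (r₁ₐ, r₀). -/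
/-- The function `u ↦ u² / (2ku - c)` is strictly increasing for `c ≤ ku`. -/
lemma sq_div_lt_sq_div_of_le {k c u v : ℝ} (hk : 0 < k) (hc : 0 < c)
    (hv : c ≤ k * v) (huv : v < u) :
    v ^ 2 / (2 * k * v - c) < u ^ 2 / (2 * k * u - c) := by
  have hku : k * v < k * u := mul_lt_mul_of_pos_left huv hk
  have hv0 : 0 < v := pos_of_mul_pos_right (hc.trans_le hv) hk.le
  rw [div_lt_div_iff₀ (by linarith) (by linarith)]
  have hcross : 0 < 2 * k * u * v - c * (u + v) := by
    nlinarith [mul_nonneg (hv0.trans huv).le (sub_nonneg.2 hv),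
      mul_pos hv0 (sub_pos.2 (hv.trans_lt hku))]
  nlinarith [mul_pos (sub_pos.2 huv) hcross]

/-- The function `u ↦ u² / (2ku - c)` is strictly decreasing for `c / 2 < ku ≤ c`. -/
lemma sq_div_lt_sq_div_of_ge {k c u v : ℝ} (hk : 0 < k) (hc : 0 < c)
    (hv : c < 2 * k * v) (hu : k * u ≤ c) (huv : v < u) :
    u ^ 2 / (2 * k * u - c) < v ^ 2 / (2 * k * v - c) := by
  have hku : k * v < k * u := mul_lt_mul_of_pos_left huv hk
  have hv0 : 0 < v := pos_of_mul_pos_right (hc.trans hv) (by positivity)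
  rw [div_lt_div_iff₀ (by linarith) (by linarith)]
  have hcross : 0 < c * (u + v) - 2 * k * u * v := by
    nlinarith [mul_nonneg hv0.le (sub_nonneg.2 hu),
      mul_pos (hv0.trans huv) (sub_pos.2 (hku.trans_le hu))]
  nlinarith [mul_pos (sub_pos.2 huv) hcross]


/-- Assume `t_v + h·t_r < 1` and `t_c < k/(k+2w)`. Then
`0 < r₁ₐ < r₀`, the denominator of the span-of-control function `s` is
strictly positive on `(0, r₀)`, and `s` is strictly decreasing on `(0, r₁ₐ)`
and strictly increasing on `(r₁ₐ, r₀)`. -/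
theorem stmt_4 (k w tc h tv tr : ℝ)
    (hk : 0 < k) (hw : 0 < w) (htc : 0 < tc) (htc' : tc < 2 * k / (k + 2 * w))
    (hh : h ∈ Set.Ioo (0 : ℝ) 1)
    (htv : tv ∈ Set.Ioo (0 : ℝ) 1) (htr : tr ∈ Set.Ioo (0 : ℝ) 1)
    (hvr : 1 < tv + tr)
    (hlt : tv + h * tr < 1)
    (htck : tc < k / (k + 2 * w)) :
    let s : ℝ → ℝ := fun r =>
      2 * k * (1 - r + r * (tv + h * tr)) ^ 2 /
        (tc * (2 * k - (k + 2 * w) * tc - 2 * k * (1 - tv - h * tr) * r))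
    let r1a : ℝ := (k - (k + 2 * w) * tc) / (k * (1 - tv - h * tr))
    let r0 : ℝ := (2 * k - (k + 2 * w) * tc) / (2 * k * (1 - tv - h * tr))
    0 < r1a ∧ r1a < r0 ∧
    (∀ r ∈ Set.Ioo (0 : ℝ) r0,
      0 < tc * (2 * k - (k + 2 * w) * tc - 2 * k * (1 - tv - h * tr) * r)) ∧
    StrictAntiOn s (Set.Ioo 0 r1a) ∧
    StrictMonoOn s (Set.Ioo r1a r0) := by
  intro s r1a r0
  obtain ⟨a, ha⟩ : ∃ a, a = 1 - tv - h * tr := ⟨_, rfl⟩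
  obtain ⟨c, hc⟩ : ∃ c, c = (k + 2 * w) * tc := ⟨_, rfl⟩
  have ha0 : 0 < a := by linarith
  have hc0 : 0 < c := by rw [hc]; positivity
  have hck : c < k := by
    rw [lt_div_iff₀ (by positivity)] at htck
    linarith
  have hr1a : r1a = (k - c) / (k * a) := by simp only [r1a, ha, hc]
  have hr0 : r0 = (2 * k - c) / (2 * k * a) := by simp only [r0, ha, hc]
  have hs (r : ℝ) : s r = 2 * k / tc * ((1 - a * r) ^ 2 / (2 * k * (1 - a * r) - c)) := by
    simp only [s]
    rw [div_mul_div_comm, ha, hc]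
    congr 1 <;> ring
  have hfac : 0 < 2 * k / tc := by positivity
  have hlt_r0 {r : ℝ} (hr : r < r0) : c < 2 * k * (1 - a * r) := by
    rw [hr0, lt_div_iff₀ (by positivity)] at hr
    linarith
  refine ⟨?_, ?_, fun r hr => ?_, fun x hx y hy hxy => ?_, fun x hx y hy hxy => ?_⟩
  · rw [hr1a]
    exact div_pos (sub_pos.2 hck) (by positivity)
  · rw [hr1a, hr0, div_lt_div_iff₀ (by positivity) (by positivity)]
    nlinarith [mul_pos hc0 (mul_pos hk ha0)]
  · rw [← ha, ← hc]
    exact mul_pos htc (by linarith [hlt_r0 hr.2])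
  · have hy1 := hy.2
    rw [hr1a, lt_div_iff₀ (by positivity)] at hy1
    rw [hs, hs]
    refine mul_lt_mul_of_pos_left (sq_div_lt_sq_div_of_le hk hc0 (by linarith) ?_) hfac
    linarith [mul_lt_mul_of_pos_left hxy ha0]
  · have hx1 := hx.1
    rw [hr1a, div_lt_iff₀ (by positivity)] at hx1
    rw [hs, hs]
    refine mul_lt_mul_of_pos_left
      (sq_div_lt_sq_div_of_ge hk hc0 (hlt_r0 hy.2) (by linarith) ?_) hfac
    linarith [mul_lt_mul_of_pos_left hxy ha0]
end

section
/- Fix r_t ∈ (0,1) and assume t_v + t_r > 1. Define the span-of-control function σ(h) = 2k·[1 − r_t + r_t·(t_v + h·t_r)]² / (t_c·[2k − (k+2w)·t_c − 2k·(1 − t_v − h·t_r)·r_t]) and h₂ᵦ = ((k+2w)·t_c − k + r_t·k·(1 − t_v))/(k·t_r·r_t). Then, on the set of h ∈ (0, (1 − t_v)/t_r) for which 2k − (k+2w)·t_c − 2k·(1 − t_v − h·t_r)·r_t > 0, σ is strictly decreasing in h for h < h₂ᵦ and strictly increasing in h for h > h₂ᵦ. -/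
/-- Cross-multiplied difference of two values of `A ↦ A² / (2kA - c)`. -/
theorem sq_mul_sub_sq_mul_eq (k c A B : ℝ) :
    2 * k * (A ^ 2 * (2 * k * B - c) - B ^ 2 * (2 * k * A - c)) =
      (B - A) * (c ^ 2 - (2 * k * A - c) * (2 * k * B - c)) := by
  ring

theorem sq_div_strictAntiOn {k c : ℝ} (hk : 0 < k) :
    StrictAntiOn (fun A : ℝ => A ^ 2 / (2 * k * A - c)) {A | 0 < 2 * k * A - c ∧ k * A < c} := by
  rintro A ⟨hA, hA'⟩ B ⟨hB, hB'⟩ hAB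
  have hprod : (2 * k * A - c) * (2 * k * B - c) < c ^ 2 := by
    rw [pow_two]
    exact mul_lt_mul'' (by linarith) (by linarith) hA.le hB.le
  have hpos := mul_pos (sub_pos.2 hAB) (sub_pos.2 hprod)
  rw [← sq_mul_sub_sq_mul_eq, mul_pos_iff_of_pos_left (by positivity)] at hpos
  exact (div_lt_div_iff₀ hB hA).2 (by linarith)

theorem sq_div_strictMonoOn {k c : ℝ} (hk : 0 < k) (hc : 0 < c) :
    StrictMonoOn (fun A : ℝ => A ^ 2 / (2 * k * A - c)) {A | c < k * A} := by
  intro A hA B hB hAB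
  simp only [Set.mem_ofPred_eq] at hA hB
  have hprod : c ^ 2 < (2 * k * A - c) * (2 * k * B - c) := by
    rw [pow_two]
    exact mul_lt_mul'' (by linarith) (by linarith) hc.le hc.le
  have hneg := mul_pos (sub_pos.2 hAB) (sub_pos.2 hprod)
  have hid := sq_mul_sub_sq_mul_eq k c A B
  have hpos : 0 < 2 * k * (B ^ 2 * (2 * k * A - c) - A ^ 2 * (2 * k * B - c)) := by linarith
  rw [mul_pos_iff_of_pos_left (by positivity)] at hpos
  exact (div_lt_div_iff₀ (by linarith) (by linarith)).2 (by linarith)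

/-- Fix `r_t ∈ (0,1)` and assume `t_v + t_r > 1`. On the set of
`h ∈ (0, (1−t_v)/t_r)` for which `2k − (k+2w)t_c − 2k(1−t_v−h·t_r)·r_t > 0`,
the span-of-control function `σ` is strictly decreasing in `h` for `h < h₂ᵦ`
and strictly increasing in `h` for `h > h₂ᵦ`. -/
theorem stmt_5 (k w tc rt tv tr : ℝ)
    (hk : 0 < k) (hw : 0 < w) (htc : 0 < tc) (htc' : tc < 2 * k / (k + 2 * w))
    (hrt : rt ∈ Set.Ioo (0 : ℝ) 1)
    (htv : tv ∈ Set.Ioo (0 : ℝ) 1) (htr : tr ∈ Set.Ioo (0 : ℝ) 1)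
    (hvr : 1 < tv + tr) :
    let σ : ℝ → ℝ := fun h =>
      2 * k * (1 - rt + rt * (tv + h * tr)) ^ 2 /
        (tc * (2 * k - (k + 2 * w) * tc - 2 * k * (1 - tv - h * tr) * rt))
    let h2b : ℝ := ((k + 2 * w) * tc - k + rt * k * (1 - tv)) / (k * tr * rt)
    let S : Set ℝ := {h | 0 < h ∧ h < (1 - tv) / tr ∧
      0 < 2 * k - (k + 2 * w) * tc - 2 * k * (1 - tv - h * tr) * rt}
    StrictAntiOn σ (S ∩ Set.Iio h2b) ∧ StrictMonoOn σ (S ∩ Set.Ioi h2b) := by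
  intro σ h2b S
  obtain ⟨hrt, -⟩ := hrt
  obtain ⟨htr, -⟩ := htr
  have hc : 0 < (k + 2 * w) * tc := by positivity
  have hkd : 0 < k * tr * rt := by positivity
  let A : ℝ → ℝ := fun h => 1 - rt + rt * (tv + h * tr)
  have hσ (h : ℝ) :
      σ h = 2 * k / tc * (A h ^ 2 / (2 * k * A h - (k + 2 * w) * tc)) := by
    rw [div_mul_div_comm]
    simp only [σ, A]
    ring_nf
  have hcoef : 0 < 2 * k / tc := by positivity
  have hA {x y : ℝ} (hxy : x < y) : A x < A y := by
    simp only [A]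
    gcongr
  have hD {x : ℝ} (hx : x ∈ S) : 0 < 2 * k * A x - (k + 2 * w) * tc := by
    have := hx.2.2
    simp only [A]
    linarith
  constructor
  · have hlt {x : ℝ} (hx : x < h2b) : k * A x < (k + 2 * w) * tc := by
      have := (lt_div_iff₀ hkd).1 hx
      simp only [A]
      linarith
    rintro x ⟨hxS, hx⟩ y ⟨hyS, hy⟩ hxy
    rw [hσ, hσ]
    exact mul_lt_mul_of_pos_left
      (sq_div_strictAntiOn hk ⟨hD hxS, hlt hx⟩ ⟨hD hyS, hlt hy⟩ (hA hxy)) hcoef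
  · have hgt {x : ℝ} (hx : h2b < x) : (k + 2 * w) * tc < k * A x := by
      have := (div_lt_iff₀ hkd).1 hx
      simp only [A]
      linarith
    rintro x ⟨-, hx⟩ y ⟨-, hy⟩ hxy
    rw [hσ, hσ]
    exact mul_lt_mul_of_pos_left (sq_div_strictMonoOn hk hc (hgt hx) (hgt hy) (hA hxy)) hcoef
end

section
/- The supremum of Π_g over [0,1] strictly exceeds the supremum of Π₀ over [0,1] (adoption of worker-level augmentation is profitable) if and only if h < 1 − t_v/t_c. -/
/-- Adoption of worker-level augmentation is profitable
(the supremum of `Π_g` over `[0,1]` strictly exceeds the supremum of `Π₀`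
over `[0,1]`) if and only if `h < 1 − t_v/t_c`. -/
theorem stmt_6 (k w tc rg h tv : ℝ)
    (hk : 0 < k) (hw : 0 < w) (htc : 0 < tc) (htc' : tc < 2 * k / (k + 2 * w))
    (hrg : rg ∈ Set.Ioo (0 : ℝ) 1) (hh : h ∈ Set.Ioo (0 : ℝ) 1)
    (htv : tv ∈ Set.Ioo (0 : ℝ) 1) :
    let P0 : ℝ → ℝ := fun x => 1 - (w + k * x ^ 2 / 2) - (w + k / 2) * (1 - x) * tc
    let Pg : ℝ → ℝ := fun x =>
      1 - (w + k * x ^ 2 / 2)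
        - (w + k / 2) * (rg * (1 - x) * (tv + h * tc) + (1 - rg) * (1 - x) * tc)
    sSup (Pg '' Set.Icc 0 1) > sSup (P0 '' Set.Icc 0 1) ↔ h < 1 - tv / tc := by
  intro P0 Pg
  have hbdd : ∀ f : ℝ → ℝ, Continuous f → BddAbove (f '' Set.Icc 0 1) := fun f hf =>
    (isCompact_Icc.image hf).bddAbove
  have hne : (Set.Icc (0 : ℝ) 1).Nonempty := ⟨0, by simp⟩
  have hdiff : ∀ x, Pg x = P0 x + (w + k / 2) * (1 - x) * (rg * (tc - tv - h * tc)) := by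
    intro x; simp only [P0, Pg]; ring
  have hcond : h < 1 - tv / tc ↔ 0 < tc - tv - h * tc := by
    rw [lt_sub_comm, div_lt_iff₀ htc]
    constructor <;> intro _ <;> linarith
  rw [hcond]
  constructor
  · contrapose!
    intro hle
    apply csSup_le (hne.image _)
    rintro _ ⟨x, hx, rfl⟩
    refine le_trans ?_ (le_csSup (hbdd P0 (by fun_prop)) (Set.mem_image_of_mem _ hx))
    have h1 : 0 ≤ (w + k / 2) * (1 - x) := mul_nonneg (by positivity) (by linarith [hx.2])
    have h2 := mul_nonpos_of_nonneg_of_nonpos h1 (mul_nonpos_of_nonneg_of_nonpos hrg.1.le hle)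
    linarith [hdiff x]
  · intro hpos
    set x₀ : ℝ := (k + 2 * w) * tc / (2 * k) with hx₀
    have hx₀_pos : 0 < x₀ := by positivity
    have hx₀_lt : x₀ < 1 := by
      rw [lt_div_iff₀ (by positivity)] at htc'
      rw [hx₀, div_lt_one (by positivity)]
      linarith
    have hmax : sSup (P0 '' Set.Icc 0 1) ≤ P0 x₀ := by
      apply csSup_le (hne.image _)
      rintro _ ⟨x, -, rfl⟩
      have hsq : P0 x = P0 x₀ - k / 2 * (x - x₀) ^ 2 := by
        simp only [P0, hx₀]; field_simp; ring
      have : 0 ≤ k / 2 * (x - x₀) ^ 2 := by positivity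
      linarith
    have hgain : 0 < (w + k / 2) * (1 - x₀) * (rg * (tc - tv - h * tc)) :=
      mul_pos (mul_pos (by positivity) (by linarith)) (mul_pos hrg.1 hpos)
    calc sSup (P0 '' Set.Icc 0 1) ≤ P0 x₀ := hmax
      _ < Pg x₀ := by linarith [hdiff x₀]
      _ ≤ sSup (Pg '' Set.Icc 0 1) :=
        le_csSup (hbdd Pg (by fun_prop)) (Set.mem_image_of_mem _ ⟨hx₀_pos.le, hx₀_lt.le⟩)
end

section
/- Assume h < 1 − t_v/t_c. Then x_g* = (k+2w)·[r_g·t_v + (1 + r_g·h − r_g)·t_c]/(2k) lies in (0,1), is the unique maximizer of Π_g over [0,1], and satisfies x_g* < x₀*. Moreover x_g* is strictly decreasing in r_g and strictly increasing in h. -/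
/-- Assume `h < 1 − t_v/t_c`. Then
`x_g* = (k+2w)[r_g·t_v + (1 + r_g·h − r_g)·t_c]/(2k)` lies in `(0,1)`, is the
unique maximizer of `Π_g` over `[0,1]`, satisfies `x_g* < x₀*`, is strictly
decreasing in `r_g`, and strictly increasing in `h`. -/
theorem stmt_7 (k w tc rg h tv : ℝ)
    (hk : 0 < k) (hw : 0 < w) (htc : 0 < tc) (htc' : tc < 2 * k / (k + 2 * w))
    (hrg : rg ∈ Set.Ioo (0 : ℝ) 1) (hh : h ∈ Set.Ioo (0 : ℝ) 1)
    (htv : tv ∈ Set.Ioo (0 : ℝ) 1)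
    (hadopt : h < 1 - tv / tc) :
    let x0 : ℝ := (k + 2 * w) * tc / (2 * k)
    let xg : ℝ := (k + 2 * w) * (rg * tv + (1 + rg * h - rg) * tc) / (2 * k)
    let Pg : ℝ → ℝ := fun x =>
      1 - (w + k * x ^ 2 / 2)
        - (w + k / 2) * (rg * (1 - x) * (tv + h * tc) + (1 - rg) * (1 - x) * tc)
    xg ∈ Set.Ioo (0 : ℝ) 1 ∧
    IsMaxOn Pg (Set.Icc (0 : ℝ) 1) xg ∧
    (∀ x ∈ Set.Icc (0 : ℝ) 1, Pg x = Pg xg → x = xg) ∧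
    xg < x0 ∧
    StrictAntiOn
      (fun r => (k + 2 * w) * (r * tv + (1 + r * h - r) * tc) / (2 * k))
      (Set.Ioo 0 1) ∧
    StrictMonoOn
      (fun h' => (k + 2 * w) * (rg * tv + (1 + rg * h' - rg) * tc) / (2 * k))
      (Set.Ioo 0 (1 - tv / tc)) := by
  intro x0 xg Pg
  obtain ⟨hr0, hr1⟩ := hrg
  have hA : 0 < k + 2 * w := by positivity
  have h2k : 0 < 2 * k := by positivity
  have hcap : (k + 2 * w) * tc < 2 * k := by
    rw [lt_div_iff₀ hA] at htc'
    linarith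
  have hsave : tv + h * tc < tc := by
    have := mul_lt_mul_of_pos_right hadopt htc
    rw [sub_mul, div_mul_cancel₀ _ htc.ne'] at this
    linarith
  have hpos : 0 < rg * tv + (1 + rg * h - rg) * tc := by
    nlinarith [mul_pos hr0 htv.1, mul_pos (mul_pos hr0 hh.1) htc,
      mul_pos (sub_pos.2 hr1) htc]
  have hlt : rg * tv + (1 + rg * h - rg) * tc < tc := by
    nlinarith [mul_pos hr0 (sub_pos.2 hsave)]
  have hxg : xg < x0 :=
    div_lt_div_of_pos_right (mul_lt_mul_of_pos_left hlt hA) h2k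
  have hx0 : x0 < 1 := (div_lt_one h2k).2 hcap
  have hgap : ∀ x, Pg x = Pg xg - k / 2 * (x - xg) ^ 2 := by
    intro x
    simp only [Pg, xg]
    field_simp
    ring
  refine ⟨⟨div_pos (mul_pos hA hpos) h2k, hxg.trans hx0⟩, ?_, ?_, hxg, ?_, ?_⟩
  · intro x _
    change Pg x ≤ Pg xg
    rw [hgap x]
    exact sub_le_self _ (by positivity)
  · intro x _ hx
    have hsq : k / 2 * (x - xg) ^ 2 = 0 := by linarith [hgap x]
    have : (x - xg) ^ 2 = 0 := (mul_eq_zero.1 hsq).resolve_left (by positivity)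
    exact sub_eq_zero.1 (pow_eq_zero_iff two_ne_zero |>.1 this)
  · intro a _ b _ hab
    refine div_lt_div_of_pos_right (mul_lt_mul_of_pos_left ?_ hA) h2k
    nlinarith [mul_pos (sub_pos.2 hab) (sub_pos.2 hsave)]
  · intro a _ b _ hab
    refine div_lt_div_of_pos_right (mul_lt_mul_of_pos_left ?_ hA) h2k
    nlinarith [mul_pos (mul_pos hr0 htc) (sub_pos.2 hab)]
end

section
/- Assume h < 1 − t_v/t_c. Define the optimal span of control s_g*(r_g) = 2k / ([t_c − r_g·(t_c − t_v − h·t_c)]·[(2w+k)·(t_c − t_v − h·t_c)·r_g + 2k − (k+2w)·t_c]) and r₂ = ((k+2w)·t_c − k)/((k+2w)·(t_c − t_v − h·t_c)). Then s_g* is strictly decreasing in r_g at every r_g ∈ (0,1) with r_g < r₂ and strictly increasing in r_g at every r_g ∈ (0,1) with r_g > r₂. -/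
/-- Assume `h < 1 − t_v/t_c`. The optimal span of control
`s_g*(r_g)` is strictly decreasing in `r_g` at every `r_g ∈ (0,1)` with
`r_g < r₂`, and strictly increasing at every `r_g ∈ (0,1)` with `r_g > r₂`. -/
theorem stmt_8 (k w tc h tv : ℝ)
    (hk : 0 < k) (hw : 0 < w) (htc : 0 < tc) (htc' : tc < 2 * k / (k + 2 * w))
    (hh : h ∈ Set.Ioo (0 : ℝ) 1) (htv : tv ∈ Set.Ioo (0 : ℝ) 1)
    (hadopt : h < 1 - tv / tc) :
    let sg : ℝ → ℝ := fun rg =>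
      2 * k / ((tc - rg * (tc - tv - h * tc)) *
        ((2 * w + k) * (tc - tv - h * tc) * rg + 2 * k - (k + 2 * w) * tc))
    let r2 : ℝ := ((k + 2 * w) * tc - k) / ((k + 2 * w) * (tc - tv - h * tc))
    StrictAntiOn sg (Set.Ioo (0 : ℝ) 1 ∩ Set.Iio r2) ∧
    StrictMonoOn sg (Set.Ioo (0 : ℝ) 1 ∩ Set.Ioi r2) := by
  intro sg r2
  have hM : 0 < k + 2 * w := by positivity
  rw [lt_div_iff₀ hM] at htc'
  have hd : 0 < tc - tv - h * tc := by
    have := mul_lt_mul_of_pos_right hadopt htc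
    rw [sub_mul, div_mul_cancel₀ _ htc.ne'] at this
    linarith
  have hdtc : tc - tv - h * tc < tc := by
    have := mul_pos hh.1 htc
    linarith [htv.1]
  simp only [sg, r2]
  clear_value sg r2
  generalize tc - tv - h * tc = d at hd hdtc ⊢
  have hMd : 0 < (k + 2 * w) * d := mul_pos hM hd
  have hpos : ∀ r ∈ Set.Ioo (0 : ℝ) 1,
      0 < (tc - r * d) * ((2 * w + k) * d * r + 2 * k - (k + 2 * w) * tc) := by
    intro r hr
    apply mul_pos
    · linarith [mul_lt_mul_of_pos_right hr.2 hd]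
    · linarith [mul_pos hMd hr.1]
  constructor
  · rintro x ⟨hx, hx2⟩ y ⟨hy, hy2⟩ hxy
    rw [Set.mem_Iio, lt_div_iff₀ hMd] at hx2 hy2
    refine div_lt_div_of_pos_left (by positivity) (hpos x hx) ?_
    have := mul_pos (mul_pos hd (sub_pos.2 hxy)) (add_pos (sub_pos.2 hx2) (sub_pos.2 hy2))
    linarith
  · rintro x ⟨hx, hx2⟩ y ⟨hy, hy2⟩ hxy
    rw [Set.mem_Ioi, div_lt_iff₀ hMd] at hx2 hy2
    refine div_lt_div_of_pos_left (by positivity) (hpos y hy) ?_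
    have := mul_pos (mul_pos hd (sub_pos.2 hxy)) (add_pos (sub_pos.2 hx2) (sub_pos.2 hy2))
    linarith
end

section
/- Fix r_g ∈ (0,1) and assume t_v < t_c. Define h₂ = (r_g·(k+2w)·(t_c − t_v) − (k+2w)·t_c + k)/(r_g·(k+2w)·t_c). Then, as a function of h on (0, 1 − t_v/t_c), the optimal span of control s_g*(h) = 2k / ([t_c − r_g·(t_c − t_v − h·t_c)]·[(2w+k)·(t_c − t_v − h·t_c)·r_g + 2k − (k+2w)·t_c]) is strictly decreasing for h < h₂ and strictly increasing for h > h₂. -/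
/-- The reciprocal parabola `u ↦ 2 * k / (u * (2 * k - c * u))` decreases left of `k / c`. -/
lemma recip_parabola_lt_of_lt_vertex {k c u v : ℝ} (hk : 0 < k) (hc : 0 < c) (hu : 0 < u)
    (huv : u < v) (hv : c * v < k) :
    2 * k / (v * (2 * k - c * v)) < 2 * k / (u * (2 * k - c * u)) := by
  have hcu : c * u < c * v := mul_lt_mul_of_pos_left huv hc
  have hpos : 0 < u * (2 * k - c * u) := mul_pos hu (by linarith)
  refine div_lt_div_of_pos_left (by linarith) hpos ?_
  have : 0 < (v - u) * (2 * k - c * u - c * v) := mul_pos (by linarith) (by linarith)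
  linarith

/-- The reciprocal parabola `u ↦ 2 * k / (u * (2 * k - c * u))` increases on `(k / c, 2 * k / c)`. -/
lemma recip_parabola_lt_of_vertex_lt {k c u v : ℝ} (hc : 0 < c) (hu : 0 < u)
    (huv : u < v) (hku : k < c * u) (hv : c * v < 2 * k) :
    2 * k / (u * (2 * k - c * u)) < 2 * k / (v * (2 * k - c * v)) := by
  have hcu : c * u < c * v := mul_lt_mul_of_pos_left huv hc
  have hpos : 0 < v * (2 * k - c * v) := mul_pos (by linarith) (by linarith)
  refine div_lt_div_of_pos_left (by linarith) hpos ?_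
  have : 0 < (v - u) * (c * u + c * v - 2 * k) := mul_pos (by linarith) (by linarith)
  linarith

/-- Fix `r_g ∈ (0,1)` and assume `t_v < t_c`. As a function of
`h` on `(0, 1 − t_v/t_c)`, the optimal span of control `s_g*(h)` is strictly
decreasing for `h < h₂` and strictly increasing for `h > h₂`. -/
theorem stmt_9 (k w tc rg tv : ℝ)
    (hk : 0 < k) (hw : 0 < w) (htc : 0 < tc) (htc' : tc < 2 * k / (k + 2 * w))
    (hrg : rg ∈ Set.Ioo (0 : ℝ) 1) (htv : tv ∈ Set.Ioo (0 : ℝ) 1)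
    (htvc : tv < tc) :
    let h2 : ℝ := (rg * (k + 2 * w) * (tc - tv) - (k + 2 * w) * tc + k) /
      (rg * (k + 2 * w) * tc)
    let sg : ℝ → ℝ := fun h =>
      2 * k / ((tc - rg * (tc - tv - h * tc)) *
        ((2 * w + k) * (tc - tv - h * tc) * rg + 2 * k - (k + 2 * w) * tc))
    StrictAntiOn sg (Set.Ioo 0 (1 - tv / tc) ∩ Set.Iio h2) ∧
    StrictMonoOn sg (Set.Ioo 0 (1 - tv / tc) ∩ Set.Ioi h2) := by
  intro h2 sg
  obtain ⟨hr0, hr1⟩ := hrg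
  have hc : 0 < k + 2 * w := by positivity
  have hctc : (k + 2 * w) * tc < 2 * k := by
    rw [lt_div_iff₀ hc] at htc'
    linarith
  have hD : 0 < rg * (k + 2 * w) * tc := by positivity
  let u : ℝ → ℝ := fun h => tc - rg * (tc - tv - h * tc)
  have hsg : ∀ h, sg h = 2 * k / (u h * (2 * k - (k + 2 * w) * u h)) := by
    intro h
    simp only [sg, u]
    congr 2
    ring
  have hu_mono : ∀ {a b : ℝ}, a < b → u a < u b := by
    intro a b hab
    have := mul_pos (mul_pos hr0 htc) (sub_pos.2 hab)
    simp only [u]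
    linarith
  have hu_pos : ∀ {a : ℝ}, 0 < a → 0 < u a := by
    intro a ha
    have h1 := mul_pos hr0 (mul_pos ha htc)
    have h2 := mul_pos hr0 htv.1
    have h3 := mul_pos (sub_pos.2 hr1) htc
    simp only [u]
    linarith
  have hu_lt : ∀ {a : ℝ}, a < 1 - tv / tc → (k + 2 * w) * u a < 2 * k := by
    intro a ha
    have h1 : tv < (1 - a) * tc := (div_lt_iff₀ htc).1 (by linarith)
    have h2 : u a < tc := by
      have := mul_pos hr0 (sub_pos.2 h1)
      simp only [u]
      linarith
    exact (mul_lt_mul_of_pos_left h2 hc).trans hctc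
  constructor
  · rintro a ⟨ha, -⟩ b ⟨-, hb2⟩ hab
    rw [hsg, hsg]
    refine recip_parabola_lt_of_lt_vertex hk hc (hu_pos ha.1) (hu_mono hab) ?_
    have := (lt_div_iff₀ hD).1 (Set.mem_Iio.1 hb2)
    simp only [u]
    linarith
  · rintro a ⟨ha, ha2⟩ b ⟨hb, -⟩ hab
    rw [hsg, hsg]
    refine recip_parabola_lt_of_vertex_lt hc (hu_pos ha.1) (hu_mono hab) ?_ (hu_lt hb.2)
    have := (div_lt_iff₀ hD).1 (Set.mem_Ioi.1 ha2)
    simp only [u]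
    linarith
end

section
/- The supremum of Π_e over [0,1] strictly exceeds the supremum of Π₀ over [0,1] (adoption of expert-level automation is profitable) if and only if both h < 1 − t_v/t_c and r_e > r̄_e, where r̄_e = (k+2w)·(h·t_c + t_c + t_v)/(4k). -/
/-- Adoption of expert-level automation is profitable
(the supremum of `Π_e` over `[0,1]` strictly exceeds the supremum of `Π₀`
over `[0,1]`) if and only if both `h < 1 − t_v/t_c` and `r_e > r̄_e`, where
`r̄_e = (k+2w)(h·t_c + t_c + t_v)/(4k)`. -/
theorem stmt_10 (k w tc re h tv : ℝ)
    (hk : 0 < k) (hw : 0 < w) (htc : 0 < tc) (htc' : tc < 2 * k / (k + 2 * w))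
    (hre : re ∈ Set.Ioo (0 : ℝ) 1) (hh : h ∈ Set.Ioo (0 : ℝ) 1)
    (htv : tv ∈ Set.Ioo (0 : ℝ) 1) :
    let P0 : ℝ → ℝ := fun x => 1 - (w + k * x ^ 2 / 2) - (w + k / 2) * (1 - x) * tc
    let Pe : ℝ → ℝ := fun x =>
      if x ≤ re then
        1 - (w + k * x ^ 2 / 2)
          - (w + k / 2) * ((1 - re) * tc + (re - x) * (tv + h * tc))
      else P0 x
    sSup (Pe '' Set.Icc 0 1) > sSup (P0 '' Set.Icc 0 1) ↔
      (h < 1 - tv / tc ∧ re > (k + 2 * w) * (h * tc + tc + tv) / (4 * k)) := by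
  intro P0 Pe
  obtain ⟨hre0, hre1⟩ := hre
  obtain ⟨hh0, hh1⟩ := hh
  obtain ⟨htv0, htv1⟩ := htv
  have hkw : 0 < k + 2 * w := by positivity
  have hc : 0 < tv + h * tc := by positivity
  obtain ⟨a, ha⟩ : ∃ a, a = (k + 2 * w) * tc / (2 * k) := ⟨_, rfl⟩
  obtain ⟨b, hb⟩ : ∃ b, b = (k + 2 * w) * (tv + h * tc) / (2 * k) := ⟨_, rfl⟩
  have ha0 : 0 < a := by rw [ha]; positivity
  have hb0 : 0 < b := by rw [hb]; positivity
  have ha1 : a < 1 := by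
    rw [lt_div_iff₀ hkw] at htc'
    rw [ha, div_lt_one (by positivity)]
    linarith
  have hka : (w + k / 2) * tc = k * a := by rw [ha]; field_simp; ring
  have hkb : (w + k / 2) * (tv + h * tc) = k * b := by rw [hb]; field_simp; ring
  have hmid : (k + 2 * w) * (h * tc + tc + tv) / (4 * k) = (a + b) / 2 := by
    rw [ha, hb]; field_simp; ring
  have hba : h < 1 - tv / tc ↔ b < a := by
    have h1 : h < 1 - tv / tc ↔ tv + h * tc < tc := by
      rw [lt_sub_iff_add_lt, ← lt_sub_iff_add_lt', div_lt_iff₀ htc]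
      constructor <;> intro H <;> linarith
    rw [h1, ha, hb, div_lt_div_iff_of_pos_right (by positivity), mul_lt_mul_iff_right₀ hkw]
  have hP0 : ∀ x, P0 x = P0 a - k * (x - a) ^ 2 / 2 := by
    intro x
    simp only [P0]
    linear_combination (x - a) * hka
  have hP0_le : ∀ x, P0 x ≤ P0 a := by
    intro x
    have : 0 ≤ k * (x - a) ^ 2 / 2 := by positivity
    linarith [hP0 x]
  have hPe_P0 : ∀ x ≤ re, Pe x = P0 x + k * ((re - x) * (a - b)) := by
    intro x hx
    simp only [Pe, P0, if_pos hx]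
    linear_combination (re - x) * hka - (re - x) * hkb
  have hPe : ∀ x ≤ re, Pe x = P0 a + k * ((a - b) * (re - (a + b) / 2)) - k * (x - b) ^ 2 / 2 := by
    intro x hx
    rw [hPe_P0 x hx, hP0 x]
    ring
  have hPe_gt : ∀ x, re < x → Pe x = P0 x := fun x hx => if_neg hx.not_ge
  have hsup : sSup (P0 '' Set.Icc 0 1) = P0 a :=
    IsGreatest.csSup_eq ⟨⟨a, ⟨ha0.le, ha1.le⟩, rfl⟩, by rintro _ ⟨x, -, rfl⟩; exact hP0_le x⟩
  have hbdd : BddAbove (Pe '' Set.Icc 0 1) := by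
    refine ⟨max (P0 a) (P0 a + k * ((a - b) * (re - (a + b) / 2))), ?_⟩
    rintro _ ⟨x, -, rfl⟩
    rcases le_or_gt x re with hx | hx
    · have : 0 ≤ k * (x - b) ^ 2 / 2 := by positivity
      exact le_max_of_le_right (by linarith [hPe x hx])
    · exact le_max_of_le_left ((hPe_gt x hx).trans_le (hP0_le x))
  have hne : (Pe '' Set.Icc 0 1).Nonempty := (Set.nonempty_Icc.2 zero_le_one).image Pe
  rw [hsup, hmid, hba, gt_iff_lt, lt_csSup_iff hbdd hne]
  constructor
  · rintro ⟨_, ⟨x, -, rfl⟩, hx⟩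
    have hxre : x ≤ re := by
      by_contra! H
      exact (hx.trans_eq (hPe_gt x H)).not_ge (hP0_le x)
    have hab : b < a := by
      by_contra! H
      have h1 : k * ((re - x) * (a - b)) ≤ 0 :=
        mul_nonpos_of_nonneg_of_nonpos hk.le
          (mul_nonpos_of_nonneg_of_nonpos (sub_nonneg.2 hxre) (sub_nonpos.2 H))
      linarith [hPe_P0 x hxre, hP0_le x]
    refine ⟨hab, ?_⟩
    have h2 : 0 ≤ k * (x - b) ^ 2 / 2 := by positivity
    have h3 : 0 < k * ((a - b) * (re - (a + b) / 2)) := by linarith [hPe x hxre]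
    exact sub_pos.1 (pos_of_mul_pos_right (pos_of_mul_pos_right h3 hk.le) (sub_pos.2 hab).le)
  · rintro ⟨hab, hr⟩
    refine ⟨_, ⟨b, ⟨hb0.le, by linarith⟩, rfl⟩, ?_⟩
    have h1 : 0 < k * ((a - b) * (re - (a + b) / 2)) :=
      mul_pos hk (mul_pos (sub_pos.2 hab) (sub_pos.2 hr))
    rw [hPe b (by linarith)]
    simpa using h1
end

section
/- Assume h < 1 − t_v/t_c and r_e > (k+2w)·(h·t_c + t_c + t_v)/(4k). Then x_e* = (k+2w)·(t_v + h·t_c)/(2k) is the unique maximizer of Π_e over [0,1], x_e* < x₀*, the formula for x_e* does not involve r_e, and x_e* is strictly increasing in h. -/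
/-- Assume `h < 1 − t_v/t_c` and
`r_e > (k+2w)(h·t_c + t_c + t_v)/(4k)`. Then `x_e* = (k+2w)(t_v + h·t_c)/(2k)`
is the unique maximizer of `Π_e` over `[0,1]`, `x_e* < x₀*`, the formula does
not involve `r_e` (as a function of `r_e` it is constant), and `x_e*` is
strictly increasing in `h`. -/
theorem stmt_11 (k w tc re h tv : ℝ)
    (hk : 0 < k) (hw : 0 < w) (htc : 0 < tc) (htc' : tc < 2 * k / (k + 2 * w))
    (hre : re ∈ Set.Ioo (0 : ℝ) 1) (hh : h ∈ Set.Ioo (0 : ℝ) 1)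
    (htv : tv ∈ Set.Ioo (0 : ℝ) 1)
    (hadopt1 : h < 1 - tv / tc)
    (hadopt2 : re > (k + 2 * w) * (h * tc + tc + tv) / (4 * k)) :
    let P0 : ℝ → ℝ := fun x => 1 - (w + k * x ^ 2 / 2) - (w + k / 2) * (1 - x) * tc
    let Pe : ℝ → ℝ := fun x =>
      if x ≤ re then
        1 - (w + k * x ^ 2 / 2)
          - (w + k / 2) * ((1 - re) * tc + (re - x) * (tv + h * tc))
      else P0 x
    let x0 : ℝ := (k + 2 * w) * tc / (2 * k)
    let xeF : ℝ → ℝ := fun _re' => (k + 2 * w) * (tv + h * tc) / (2 * k)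
    let xe : ℝ := xeF re
    IsMaxOn Pe (Set.Icc (0 : ℝ) 1) xe ∧
    (∀ x ∈ Set.Icc (0 : ℝ) 1, Pe x = Pe xe → x = xe) ∧
    xe < x0 ∧
    (∀ re₁ re₂ : ℝ, xeF re₁ = xeF re₂) ∧
    StrictMono (fun h' : ℝ => (k + 2 * w) * (tv + h' * tc) / (2 * k)) := by
  intro P0 Pe x0 xeF xe
  have hslope : tv + h * tc < tc := by
    have htv_div : tv / tc < 1 - h := by linarith
    rw [div_lt_iff₀ htc] at htv_div
    linarith
  have hkxe : (w + k / 2) * (tv + h * tc) = k * xe := by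
    simp only [xe, xeF]
    field_simp
    ring
  have hkx0 : (w + k / 2) * tc = k * x0 := by
    simp only [x0]
    field_simp
    ring
  have hlt : xe < x0 := by
    simp only [xe, xeF, x0]
    gcongr
  have hmid : (xe + x0) / 2 < re := by
    have hmid_eq : (xe + x0) / 2 = (k + 2 * w) * (h * tc + tc + tv) / (4 * k) := by
      simp only [xe, xeF, x0]
      field_simp
      ring
    rw [hmid_eq]
    exact hadopt2
  have hxe_le : xe ≤ re := by linarith
  have hstrict : ∀ x, x ≠ xe → Pe x < Pe xe := by
    intro x hne
    by_cases hx : x ≤ re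
    · have hdiff : Pe xe - Pe x = k / 2 * (x - xe) ^ 2 := by
        simp only [Pe, if_pos hx, if_pos hxe_le]
        linear_combination (xe - x) * hkxe
      have hsq : 0 < (x - xe) ^ 2 := by
        have := sub_ne_zero.mpr hne
        positivity
      have : 0 < k / 2 * (x - xe) ^ 2 := by positivity
      linarith
    · have hdiff : Pe xe - Pe x =
          k / 2 * (x - x0) ^ 2 + k * ((x0 - xe) * (re - (xe + x0) / 2)) := by
        simp only [Pe, P0, if_neg hx, if_pos hxe_le]
        linear_combination (xe - re) * hkxe + (re - x) * hkx0
      have hgap : 0 < k * ((x0 - xe) * (re - (xe + x0) / 2)) :=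
        mul_pos hk (mul_pos (sub_pos.mpr hlt) (sub_pos.mpr hmid))
      have : 0 ≤ k / 2 * (x - x0) ^ 2 := by positivity
      linarith
  refine ⟨fun x _ => ?_, fun x _ hx => ?_, hlt, fun _ _ => rfl, fun a b hab => ?_⟩
  · rcases eq_or_ne x xe with rfl | hne
    · exact le_refl (Pe xe)
    · exact (hstrict x hne).le
  · by_contra hne
    exact (hstrict x hne).ne hx
  · dsimp only
    gcongr
end

section
/- Assume h < 1 − t_v/t_c, and let r̄_e = (k+2w)·(h·t_c + t_c + t_v)/(4k), x_e* = (k+2w)·(t_v + h·t_c)/(2k), s_e*(r_e) = 1/((1 − r_e)·t_c + (r_e − x_e*)·(t_v + h·t_c)), and s₀* = 1/((1 − x₀*)·t_c). Then s_e* is strictly increasing in r_e on (r̄_e, 1), and s_e*(r̄_e) < s₀* (the span of control drops discretely at the adoption threshold). -/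
/-- Assume `h < 1 − t_v/t_c`. The span of control `s_e*` is
strictly increasing in `r_e` on `(r̄_e, 1)`, and `s_e*(r̄_e) < s₀*` (the span
of control drops discretely at the adoption threshold). -/
theorem stmt_12 (k w tc h tv : ℝ)
    (hk : 0 < k) (hw : 0 < w) (htc : 0 < tc) (htc' : tc < 2 * k / (k + 2 * w))
    (hh : h ∈ Set.Ioo (0 : ℝ) 1) (htv : tv ∈ Set.Ioo (0 : ℝ) 1)
    (hadopt : h < 1 - tv / tc) :
    let x0 : ℝ := (k + 2 * w) * tc / (2 * k)
    let rbar : ℝ := (k + 2 * w) * (h * tc + tc + tv) / (4 * k)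
    let xe : ℝ := (k + 2 * w) * (tv + h * tc) / (2 * k)
    let se : ℝ → ℝ := fun re => 1 / ((1 - re) * tc + (re - xe) * (tv + h * tc))
    let s0 : ℝ := 1 / ((1 - x0) * tc)
    StrictMonoOn se (Set.Ioo rbar 1) ∧ se rbar < s0 := by
  intro x0 rbar xe se s0
  obtain ⟨hh0, -⟩ := hh
  obtain ⟨htv0, -⟩ := htv
  obtain ⟨a, ha⟩ : ∃ a : ℝ, a = (k + 2 * w) / (2 * k) := ⟨_, rfl⟩
  obtain ⟨c, hc⟩ : ∃ c : ℝ, c = tv + h * tc := ⟨_, rfl⟩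
  have ha0 : 0 < a := by rw [ha]; positivity
  have hc0 : 0 < c := by rw [hc]; positivity
  have hctc : c < tc := by
    have h1 : tv / tc < 1 - h := by linarith
    rw [div_lt_iff₀ htc] at h1
    linarith
  have hatc : a * tc < 1 := by
    rw [lt_div_iff₀ (by positivity)] at htc'
    rw [ha, div_mul_eq_mul_div, div_lt_one (by positivity)]
    linarith
  have hx0 : x0 = a * tc := by simp only [x0, ha]; ring
  have hxe : xe = a * c := by simp only [xe, ha, hc]; ring
  have hrbar : rbar = a * (c + tc) / 2 := by simp only [rbar, ha, hc]; field_simp; ring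
  have hac : a * c < 1 := (mul_lt_mul_of_pos_left hctc ha0).trans hatc
  constructor
  · intro r _ r' hr' hrr'
    simp only [se, ← hc, hxe]
    have hlast : 0 < (1 - a * c) * c := mul_pos (by linarith) hc0
    have hdec : 0 < (r' - r) * (tc - c) := mul_pos (by linarith) (by linarith)
    have hrem : 0 < (1 - r') * (tc - c) := mul_pos (by linarith [hr'.2]) (by linarith)
    exact one_div_lt_one_div_of_lt (by linarith) (by linarith)
  · simp only [se, s0, ← hc, hxe, hx0, hrbar]
    have hpos : 0 < (1 - a * tc) * tc := mul_pos (by linarith) htc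
    have hgap : 0 < a * ((tc - c) * (tc + c)) :=
      mul_pos ha0 (mul_pos (by linarith) (by linarith))
    exact one_div_lt_one_div_of_lt hpos (by linarith)
end

section
/- Fix r_e ∈ (0,1) and assume t_v < t_c. Define h₃ = (k·r_e − (k+2w)·t_v)/((k+2w)·t_c). Then, as a function of h on (0, 1 − t_v/t_c), the span s_e*(h) = 1/((1 − r_e)·t_c + (r_e − x_e*(h))·(t_v + h·t_c)), with x_e*(h) = (k+2w)·(t_v + h·t_c)/(2k), is strictly decreasing for h < h₃ and strictly increasing for h > h₃. -/
/-- Positivity of the quadratic `(1 - r) c + (r - a u) u` for `0 < u < c` when `a c < 1`. -/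
theorem quadratic_pos {a c r u : ℝ} (ha : 0 < a) (hac : a * c < 1) (hr : r < 1)
    (hu : 0 < u) (huc : u < c) : 0 < (1 - r) * c + (r - a * u) * u := by
  have h1 : 0 < (1 - r) * (c - u) := mul_pos (by linarith) (by linarith)
  have h2 : a * u < 1 := (mul_lt_mul_of_pos_left huc ha).trans hac
  have h3 : 0 < u * (1 - a * u) := mul_pos hu (by linarith)
  linarith

/-- Fix `r_e ∈ (0,1)` and assume `t_v < t_c`. As a function of
`h` on `(0, 1 − t_v/t_c)`, the span `s_e*(h)` is strictly decreasing for
`h < h₃` and strictly increasing for `h > h₃`, where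
`h₃ = (k·r_e − (k+2w)·t_v)/((k+2w)·t_c)`. -/
theorem stmt_13 (k w tc re tv : ℝ)
    (hk : 0 < k) (hw : 0 < w) (htc : 0 < tc) (htc' : tc < 2 * k / (k + 2 * w))
    (hre : re ∈ Set.Ioo (0 : ℝ) 1) (htv : tv ∈ Set.Ioo (0 : ℝ) 1)
    (htvc : tv < tc) :
    let h3 : ℝ := (k * re - (k + 2 * w) * tv) / ((k + 2 * w) * tc)
    let xe : ℝ → ℝ := fun h => (k + 2 * w) * (tv + h * tc) / (2 * k)
    let se : ℝ → ℝ := fun h =>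
      1 / ((1 - re) * tc + (re - xe h) * (tv + h * tc))
    StrictAntiOn se (Set.Ioo 0 (1 - tv / tc) ∩ Set.Iio h3) ∧
    StrictMonoOn se (Set.Ioo 0 (1 - tv / tc) ∩ Set.Ioi h3) := by
  intro h3 xe se
  obtain ⟨-, hre1⟩ := hre
  obtain ⟨htv0, -⟩ := htv
  have hkw : 0 < k + 2 * w := by linarith
  set a : ℝ := (k + 2 * w) / (2 * k) with ha_def
  have ha : 0 < a := by positivity
  have hac : a * tc < 1 := by
    rw [lt_div_iff₀ hkw] at htc'
    rw [ha_def, div_mul_eq_mul_div, div_lt_one (by positivity)]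
    linarith
  have hxe : ∀ h, xe h = a * (tv + h * tc) := fun h => by
    simp only [xe, ha_def]
    ring
  have hpos : ∀ h ∈ Set.Ioo 0 (1 - tv / tc),
      0 < (1 - re) * tc + (re - xe h) * (tv + h * tc) := by
    rintro h ⟨h0, h1⟩
    rw [hxe]
    refine quadratic_pos ha hac hre1 (by positivity) ?_
    have := mul_lt_mul_of_pos_right h1 htc
    rw [sub_mul, div_mul_cancel₀ _ htc.ne'] at this
    linarith
  have hh3 : 2 * a * (tv + h3 * tc) = re := by
    simp only [h3, ha_def]
    field_simp
    ring
  have hdiff : ∀ x y, ((1 - re) * tc + (re - xe y) * (tv + y * tc)) -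
      ((1 - re) * tc + (re - xe x) * (tv + x * tc)) =
      a * tc ^ 2 * ((y - x) * ((h3 - x) + (h3 - y))) := fun x y => by
    rw [hxe, hxe, ← hh3]
    ring
  have hatc : 0 < a * tc ^ 2 := by positivity
  constructor
  · rintro x ⟨hx, hx3 : x < h3⟩ y ⟨-, hy3 : y < h3⟩ hxy
    refine one_div_lt_one_div_of_lt (hpos x hx) ?_
    have := mul_pos hatc (mul_pos (sub_pos.2 hxy) (add_pos (sub_pos.2 hx3) (sub_pos.2 hy3)))
    linarith [hdiff x y]
  · rintro x ⟨-, hx3 : h3 < x⟩ y ⟨hy, hy3 : h3 < y⟩ hxy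
    refine one_div_lt_one_div_of_lt (hpos y hy) ?_
    have := mul_pos hatc (mul_pos (sub_pos.2 hxy) (add_pos (sub_pos.2 hx3) (sub_pos.2 hy3)))
    linarith [hdiff x y]
end

section
/- The supremum of Π_u over [0,1] strictly exceeds the supremum of Π₀ over [0,1] (adoption of expert-level augmentation is profitable) if and only if h < r_u. -/
/-- Adoption of expert-level augmentation is profitable
(the supremum of `Π_u` over `[0,1]` strictly exceeds the supremum of `Π₀`
over `[0,1]`) if and only if `h < r_u`. -/
theorem stmt_14 (k w tc ru h : ℝ)
    (hk : 0 < k) (hw : 0 < w) (htc : 0 < tc) (htc' : tc < 2 * k / (k + 2 * w))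
    (hru : ru ∈ Set.Ioo (0 : ℝ) 1) (hh : h ∈ Set.Ioo (0 : ℝ) 1) :
    let P0 : ℝ → ℝ := fun x => 1 - (w + k * x ^ 2 / 2) - (w + k / 2) * (1 - x) * tc
    let Pu : ℝ → ℝ := fun x =>
      1 - (w + k * x ^ 2 / 2)
        - (w + k / 2) * (1 - x) * ((1 - ru) * tc + h * tc)
    sSup (Pu '' Set.Icc 0 1) > sSup (P0 '' Set.Icc 0 1) ↔ h < ru := by
  intro P0 Pu
  have hbdd0 : BddAbove (P0 '' Set.Icc 0 1) :=
    isCompact_Icc.bddAbove_image (by unfold P0; fun_prop)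
  have hbddu : BddAbove (Pu '' Set.Icc 0 1) :=
    isCompact_Icc.bddAbove_image (by unfold Pu; fun_prop)
  have hne : (Set.Icc (0 : ℝ) 1).Nonempty := ⟨0, by simp⟩
  constructor
  · contrapose!
    intro hle
    refine csSup_le (hne.image _) ?_
    rintro _ ⟨x, hx, rfl⟩
    refine le_trans ?_ (le_csSup hbdd0 ⟨x, hx, rfl⟩)
    have hcoef : 0 ≤ (w + k / 2) * (1 - x) :=
      mul_nonneg (by positivity) (sub_nonneg.2 hx.2)
    have hcost := mul_nonneg hcoef (mul_nonneg (sub_nonneg.2 hle) htc.le)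
    simp only [P0, Pu]
    linarith
  · intro hlt
    obtain ⟨x₀, hx₀⟩ : ∃ x₀, x₀ = (k + 2 * w) * tc / (2 * k) := ⟨_, rfl⟩
    have hfoc : k * x₀ = (w + k / 2) * tc := by
      rw [hx₀]
      field_simp
      ring
    have hx₀_nonneg : 0 ≤ x₀ := by rw [hx₀]; positivity
    have hx₀_lt : x₀ < 1 := by
      rw [lt_div_iff₀ (by positivity)] at htc'
      rw [hx₀, div_lt_one (by positivity)]
      linarith
    have hsup : sSup (P0 '' Set.Icc 0 1) ≤ P0 x₀ := by
      refine csSup_le (hne.image _) ?_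
      rintro _ ⟨x, -, rfl⟩
      have hgap : P0 x₀ - P0 x = k / 2 * (x - x₀) ^ 2 := by
        simp only [P0]
        linear_combination (x - x₀) * hfoc
      have hsq : 0 ≤ k / 2 * (x - x₀) ^ 2 := by positivity
      linarith
    have hgain : P0 x₀ < Pu x₀ := by
      have hpos : 0 < (w + k / 2) * (1 - x₀) * ((ru - h) * tc) :=
        mul_pos (mul_pos (by positivity) (sub_pos.2 hx₀_lt)) (mul_pos (sub_pos.2 hlt) htc)
      simp only [P0, Pu]
      linarith
    exact hsup.trans_lt (hgain.trans_le (le_csSup hbddu ⟨x₀, ⟨hx₀_nonneg, hx₀_lt.le⟩, rfl⟩))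
end

section
/- Assume 0 < k < 1/t_c and t_c > 0. Then for every (x, y) in the feasible region 0 ≤ x ≤ y ≤ 1, the partial derivative of Π₀(x, y) with respect to y equals 1 − k·y·t_c·(1 − x) and is strictly positive; consequently, for each fixed x ∈ [0,1], the map y ↦ Π₀(x, y) is strictly increasing on [x, 1], so every maximizer of Π₀ over the feasible region has y = 1. -/
/-- The marginal profit of expert knowledge is positive when `k * tc < 1`. -/
lemma marginal_profit_pos {k tc x y : ℝ} (hk : 0 < k) (htc : 0 < tc) (hktc : k < 1 / tc)
    (hx : x ∈ Set.Icc (0 : ℝ) 1) (hy : y ≤ 1) :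
    0 < 1 - k * y * tc * (1 - x) := by
  have hkt : k * tc < 1 := (lt_div_iff₀ htc).mp hktc
  have hyx : y * (1 - x) ≤ 1 := by nlinarith [hx.1, hx.2]
  have := mul_le_mul_of_nonneg_left hyx (mul_pos hk htc).le
  linarith

/-- Assume `0 < k < 1/t_c` and `t_c > 0`. For every `(x,y)` in
the feasible region `0 ≤ x ≤ y ≤ 1`, the partial derivative of `Π₀(x,y)` with
respect to `y` equals `1 − k·y·t_c·(1−x)` and is strictly positive; hence for
each fixed `x ∈ [0,1]` the map `y ↦ Π₀(x,y)` is strictly increasing on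
`[x,1]`, and every maximizer of `Π₀` over the feasible region has `y = 1`. -/
theorem stmt_17 (k w tc : ℝ)
    (hk : 0 < k) (hw : 0 < w) (htc : 0 < tc) (hktc : k < 1 / tc) :
    let P : ℝ → ℝ → ℝ := fun x y =>
      y - (w + k * x ^ 2 / 2) - (w + k * y ^ 2 / 2) * (1 - x) * tc
    let S : Set (ℝ × ℝ) := {q : ℝ × ℝ | 0 ≤ q.1 ∧ q.1 ≤ q.2 ∧ q.2 ≤ 1}
    (∀ x y : ℝ, 0 ≤ x → x ≤ y → y ≤ 1 →
      HasDerivAt (fun y' => P x y') (1 - k * y * tc * (1 - x)) y ∧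
        0 < 1 - k * y * tc * (1 - x)) ∧
    (∀ x ∈ Set.Icc (0 : ℝ) 1, StrictMonoOn (fun y => P x y) (Set.Icc x 1)) ∧
    (∀ p ∈ S, IsMaxOn (fun q : ℝ × ℝ => P q.1 q.2) S p → p.2 = 1) := by
  intro P S
  have mono : ∀ x ∈ Set.Icc (0 : ℝ) 1, StrictMonoOn (fun y => P x y) (Set.Icc x 1) := by
    intro x hx a ha b hb hab
    have hmid : (a + b) / 2 ≤ 1 := by linarith [ha.2, hb.2]
    have hdiff : P x b - P x a = (b - a) * (1 - k * ((a + b) / 2) * tc * (1 - x)) := by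
      simp only [P]
      ring
    have := mul_pos (sub_pos.mpr hab) (marginal_profit_pos hk htc hktc hx hmid)
    exact sub_pos.mp (hdiff ▸ this)
  refine ⟨fun x y hx hxy hy => ⟨?_, ?_⟩, mono, ?_⟩
  · have hcost : HasDerivAt (fun y' : ℝ => w + k * y' ^ 2 / 2) (k * y) y := by
      refine ((((hasDerivAt_pow 2 y).const_mul k).div_const 2).const_add w).congr_deriv ?_
      norm_num
      ring
    refine (((hasDerivAt_id y).sub_const (w + k * x ^ 2 / 2)).sub
      ((hcost.mul_const (1 - x)).mul_const tc)).congr_deriv ?_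
    ring
  · exact marginal_profit_pos hk htc hktc ⟨hx, hxy.trans hy⟩ hy
  · rintro ⟨x, y⟩ ⟨hx, hxy, hy⟩ hmax
    by_contra hne
    have hlt : y < 1 := lt_of_le_of_ne hy hne
    have hx1 : x ≤ 1 := hxy.trans hy
    have hle : P x 1 ≤ P x y := hmax (show (x, (1 : ℝ)) ∈ S from ⟨hx, hx1, le_rfl⟩)
    exact hle.not_gt (mono x ⟨hx, hx1⟩ ⟨hxy, hy⟩ ⟨hx1, le_rfl⟩ hlt)
end

section
/- Assume h < 1 − t_v/t_c and c > (k+2w)·(t_c − h·t_c − t_v)/2. Let x_e* = (k+2w)·(h·t_c + t_v)/(2k) and r_e* = (k+2w)·(t_c − h·t_c − t_v)/(2c). Then 0 < r_e* < 1, x_e* < x₀*, r_e* is strictly increasing as c decreases, and Π_e(x_e*, r_e*) strictly exceeds the pre-GenAI optimum Π₀(x₀*) if and only if c < k·(t_c − h·t_c − t_v)/(h·t_c + t_c + t_v). Moreover, when this adoption condition holds, the span of control s_e* = 1/((1 − r_e*)·t_c + (r_e* − x_e*)·(t_v + h·t_c)) is strictly decreasing in c (so it strictly increases as c decreases), and at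 c equal to the adoption threshold it coincides with the pre-GenAI span s₀* = 1/((1 − x₀*)·t_c). -/
/-- Expert-level automation with capability investment. Under
`h < 1 − t_v/t_c` and `c > (k+2w)(t_c − h·t_c − t_v)/2`: `0 < r_e* < 1`,
`x_e* < x₀*`, `r_e*` strictly increases as `c` decreases, adoption
(`Π_e(x_e*, r_e*) > Π₀(x₀*)`) holds iff `c < k(t_c − h·t_c − t_v)/(h·t_c + t_c + t_v)`,
and under adoption the span of control is strictly decreasing in `c`, and at
the adoption threshold it coincides with the pre-GenAI span `s₀*`. -/
theorem stmt_18 (k w tc h tv c : ℝ)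
    (hk : 0 < k) (hw : 0 < w) (htc : 0 < tc) (htc' : tc < 2 * k / (k + 2 * w))
    (hh : h ∈ Set.Ioo (0 : ℝ) 1) (htv : tv ∈ Set.Ioo (0 : ℝ) 1)
    (hadopt : h < 1 - tv / tc)
    (hc : c > (k + 2 * w) * (tc - h * tc - tv) / 2) :
    let x0 : ℝ := (k + 2 * w) * tc / (2 * k)
    let xe : ℝ := (k + 2 * w) * (h * tc + tv) / (2 * k)
    let reF : ℝ → ℝ := fun c' => (k + 2 * w) * (tc - h * tc - tv) / (2 * c')
    let re : ℝ := reF c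
    let Pe : ℝ → ℝ → ℝ := fun x r =>
      1 - (w + k * x ^ 2 / 2)
        - (w + k / 2) * ((1 - r) * tc + (r - x) * (tv + h * tc))
        - c * r ^ 2 / 2
    let P0 : ℝ → ℝ := fun x => 1 - (w + k * x ^ 2 / 2) - (w + k / 2) * (1 - x) * tc
    let cbar : ℝ := k * (tc - h * tc - tv) / (h * tc + tc + tv)
    let seF : ℝ → ℝ := fun c' =>
      1 / ((1 - reF c') * tc + (reF c' - xe) * (tv + h * tc))
    (0 < re ∧ re < 1) ∧
    xe < x0 ∧
    StrictAntiOn reF (Set.Ioi ((k + 2 * w) * (tc - h * tc - tv) / 2)) ∧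
    (Pe xe re > P0 x0 ↔ c < cbar) ∧
    StrictAntiOn seF (Set.Ioo ((k + 2 * w) * (tc - h * tc - tv) / 2) cbar) ∧
    seF cbar = 1 / ((1 - x0) * tc) := by
  obtain ⟨hh0, -⟩ := hh
  obtain ⟨htv0, -⟩ := htv
  intro x0 xe reF re Pe P0 cbar seF
  have hK : 0 < k + 2 * w := by positivity
  have ha : 0 < h * tc + tv := by positivity
  have hd : 0 < tc - h * tc - tv := by
    have h1 : tv / tc < 1 - h := by linarith
    rw [div_lt_iff₀ htc] at h1
    linarith
  have hKtc : (k + 2 * w) * tc < 2 * k := by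
    rw [lt_div_iff₀ hK] at htc'
    linarith
  have hs : 0 < h * tc + tc + tv := by positivity
  have hB : 0 < (k + 2 * w) * (tc - h * tc - tv) / 2 := by positivity
  have hc0 : 0 < c := hB.trans hc
  have hr1 : ∀ c', (k + 2 * w) * (tc - h * tc - tv) / 2 < c' → reF c' < 1 := by
    intro c' hc'
    have hc'0 : 0 < c' := hB.trans hc'
    change (k + 2 * w) * (tc - h * tc - tv) / (2 * c') < 1
    rw [div_lt_one (by positivity)]
    linarith
  have hxx : xe < x0 := by
    change (k + 2 * w) * (h * tc + tv) / (2 * k) < (k + 2 * w) * tc / (2 * k)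
    gcongr
    linarith
  have hx0 : x0 < 1 := (div_lt_one (by positivity)).2 hKtc
  have hanti : StrictAntiOn reF (Set.Ioi ((k + 2 * w) * (tc - h * tc - tv) / 2)) := by
    intro a hmem b _ hab
    have ha0 : 0 < a := hB.trans hmem
    exact div_lt_div_of_pos_left (by positivity) (by positivity) (by linarith)
  refine ⟨⟨?_, hr1 c hc⟩, hxx, hanti, ?_, ?_, ?_⟩
  · change 0 < (k + 2 * w) * (tc - h * tc - tv) / (2 * c)
    positivity
  · have hdiff : Pe xe re - P0 x0 =
        (k + 2 * w) ^ 2 * (tc - h * tc - tv) / (8 * k * c) *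
          (k * (tc - h * tc - tv) - c * (h * tc + tc + tv)) := by
      simp only [Pe, P0, xe, x0, re, reF]
      field_simp
      ring
    have hpos : 0 < (k + 2 * w) ^ 2 * (tc - h * tc - tv) / (8 * k * c) := by positivity
    rw [gt_iff_lt, ← sub_pos, hdiff, mul_pos_iff_of_pos_left hpos, sub_pos, lt_div_iff₀ hs]
  · intro a hmem b hbmem hab
    have hlt : reF b < reF a := hanti hmem.1 hbmem.1 hab
    have hra := hr1 a hmem.1
    have hxe : xe < 1 := hxx.trans hx0
    refine one_div_lt_one_div_of_lt ?_ ?_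
    · nlinarith [mul_pos hd (sub_pos.2 hra), mul_pos ha (sub_pos.2 hxe)]
    · nlinarith [mul_pos hd (sub_pos.2 hlt)]
  · have hre : reF cbar = (k + 2 * w) * (h * tc + tc + tv) / (2 * k) := by
      have hd' := hd.ne'
      simp only [reF, cbar]
      generalize tc - h * tc - tv = d at hd' ⊢
      field_simp
    simp only [seF, hre, x0, xe]
    congr 1
    field_simp
    ring
end

section
/- Let h = b·(1 − r_u) with baseline hallucination coefficient b ∈ (0,1), so that the expert-level augmentation profit becomes Π̂_u(x) = 1 − (w + (1/2)k·x²) − (w + (1/2)k)·(1 − x)·(1 + b)·(1 − r_u)·t_c. Then: (a) the supremum of Π̂_u over [0,1] strictly exceeds the supremum of Π₀ over [0,1] if and only if r_u > b/(1+b); (b) for r_u > b/(1+b), the unique maximizer of Π̂_u over [0,1] is x̂_u* = (k+2w)·(1+b)·(1 − r_u)·t_c/(2k), which is strictly decreasing in r_u and satisfies x̂_u* < x₀*; (c) the span of control ŝ_u*(r_u) = 1/((1 − x̂_u*)·(1+b)·(1 − r_u)·t_c) is strictly decreasing in r_u on (b/(1+b), r̂₄) and strictly increasing in r_u on (r̂₄,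 1), where r̂₄ = ((1+b)·(k+2w)·t_c − k)/((1+b)·(k+2w)·t_c). -/
theorem mul_one_sub_mul_lt_of_add_lt {q u v : ℝ} (huv : u < v) (h : q * (u + v) < 1) :
    (1 - q * u) * u < (1 - q * v) * v := by
  nlinarith [mul_pos (sub_pos.2 huv) (sub_pos.2 h)]

theorem mul_one_sub_mul_lt_of_lt_add {q u v : ℝ} (huv : u < v) (h : 1 < q * (u + v)) :
    (1 - q * v) * v < (1 - q * u) * u := by
  nlinarith [mul_pos (sub_pos.2 huv) (sub_pos.2 h)]

/-- Completing the square in the profit function with effective communication cost `T`. -/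
theorem profit_eq_sub_sq {k : ℝ} (hk : k ≠ 0) (w T x : ℝ) :
    1 - (w + k * x ^ 2 / 2) - (w + k / 2) * (1 - x) * T =
      1 - (w + k * ((k + 2 * w) * T / (2 * k)) ^ 2 / 2)
        - (w + k / 2) * (1 - (k + 2 * w) * T / (2 * k)) * T
        - k / 2 * (x - (k + 2 * w) * T / (2 * k)) ^ 2 := by
  field_simp
  ring


/-- Coupled capability–reliability specification for
expert-level augmentation, `h = b(1 − r_u)` with `b ∈ (0,1)`:
(a) adoption is profitable iff `r_u > b/(1+b)`;
(b) for `r_u > b/(1+b)` the unique maximizer of `Π̂_u` over `[0,1]` is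
`x̂_u* = (k+2w)(1+b)(1 − r_u)·t_c/(2k)`, strictly decreasing in `r_u` and
below `x₀*`;
(c) the span of control `ŝ_u*(r_u)` is strictly decreasing on
`(b/(1+b), r̂₄)` and strictly increasing on `(r̂₄, 1)`. -/
theorem stmt_19 (k w tc ru b : ℝ)
    (hk : 0 < k) (hw : 0 < w) (htc : 0 < tc) (htc' : tc < 2 * k / (k + 2 * w))
    (hru : ru ∈ Set.Ioo (0 : ℝ) 1) (hb : b ∈ Set.Ioo (0 : ℝ) 1) :
    let P0 : ℝ → ℝ := fun x => 1 - (w + k * x ^ 2 / 2) - (w + k / 2) * (1 - x) * tc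
    let Pu : ℝ → ℝ := fun x =>
      1 - (w + k * x ^ 2 / 2)
        - (w + k / 2) * (1 - x) * (1 + b) * (1 - ru) * tc
    let x0 : ℝ := (k + 2 * w) * tc / (2 * k)
    let xu : ℝ := (k + 2 * w) * (1 + b) * (1 - ru) * tc / (2 * k)
    let r4 : ℝ := ((1 + b) * (k + 2 * w) * tc - k) / ((1 + b) * (k + 2 * w) * tc)
    let su : ℝ → ℝ := fun r =>
      1 / ((1 - (k + 2 * w) * (1 + b) * (1 - r) * tc / (2 * k)) *
        ((1 + b) * (1 - r) * tc))
    (sSup (Pu '' Set.Icc 0 1) > sSup (P0 '' Set.Icc 0 1) ↔ ru > b / (1 + b)) ∧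
    (ru > b / (1 + b) →
      IsMaxOn Pu (Set.Icc (0 : ℝ) 1) xu ∧
      (∀ x ∈ Set.Icc (0 : ℝ) 1, Pu x = Pu xu → x = xu) ∧
      xu < x0) ∧
    StrictAntiOn (fun r => (k + 2 * w) * (1 + b) * (1 - r) * tc / (2 * k))
      (Set.Ioo (b / (1 + b)) 1) ∧
    StrictAntiOn su (Set.Ioo (b / (1 + b)) r4) ∧
    StrictMonoOn su (Set.Ioo r4 1) := by
  intro P0 Pu x0 xu r4 su
  obtain ⟨hb0, -⟩ := hb
  have hb1 : 0 < 1 + b := by linarith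
  have hK : 0 < k + 2 * w := by linarith
  have hKt : tc * (k + 2 * w) < 2 * k := (lt_div_iff₀ hK).1 htc'
  have hthreshold (r : ℝ) : b / (1 + b) < r ↔ (1 + b) * (1 - r) < 1 := by
    rw [div_lt_iff₀ hb1]
    constructor <;> intro h <;> linarith
  have hx0 : 0 < x0 := by positivity
  have hx1 : x0 < 1 := by
    rw [div_lt_one (by positivity)]
    linarith
  have hx0_mem : x0 ∈ Set.Icc (0 : ℝ) 1 := ⟨hx0.le, hx1.le⟩
  have hP0 (x : ℝ) : P0 x = P0 x0 - k / 2 * (x - x0) ^ 2 := profit_eq_sub_sq hk.ne' w tc x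
  have hPu (x : ℝ) : Pu x = Pu xu - k / 2 * (x - xu) ^ 2 := by
    have h := profit_eq_sub_sq hk.ne' w ((1 + b) * (1 - ru) * tc) x
    simp only [← mul_assoc] at h
    exact h
  have hP0_le (x : ℝ) : P0 x ≤ P0 x0 := by
    rw [hP0 x]
    exact sub_le_self _ (by positivity)
  have hPu_le (x : ℝ) : Pu x ≤ Pu xu := by
    rw [hPu x]
    exact sub_le_self _ (by positivity)
  have hdiff (x : ℝ) :
      Pu x - P0 x = (w + k / 2) * tc * (1 - x) * (1 - (1 + b) * (1 - ru)) := by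
    simp only [Pu, P0]
    ring
  have hsup : sSup (P0 '' Set.Icc 0 1) = P0 x0 :=
    IsGreatest.csSup_eq ⟨Set.mem_image_of_mem _ hx0_mem, by
      rintro _ ⟨x, -, rfl⟩
      exact hP0_le x⟩
  have hxu (r : ℝ) : (k + 2 * w) * (1 + b) * (1 - r) * tc / (2 * k) =
      (k + 2 * w) / (2 * k) * ((1 + b) * (1 - r) * tc) := by
    ring
  have hcost {r s : ℝ} (hrs : r < s) : (1 + b) * (1 - s) * tc < (1 + b) * (1 - r) * tc := by
    gcongr
  have hxu_anti {r s : ℝ} (hrs : r < s) :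
      (k + 2 * w) * (1 + b) * (1 - s) * tc / (2 * k) <
        (k + 2 * w) * (1 + b) * (1 - r) * tc / (2 * k) := by
    gcongr
  have hxu_lt {r : ℝ} (hr : b / (1 + b) < r) :
      (k + 2 * w) * (1 + b) * (1 - r) * tc / (2 * k) < x0 := by
    have h : (k + 2 * w) * (1 + b) * (1 - r) * tc / (2 * k) =
        x0 * ((1 + b) * (1 - r)) := by
      simp only [x0]
      ring
    rw [h]
    exact mul_lt_of_lt_one_right hx0 ((hthreshold r).1 hr)
  have hD : 0 < (1 + b) * (k + 2 * w) * tc := by positivity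
  have hr4_lt : r4 < 1 := by
    rw [div_lt_one hD]
    linarith
  have hhalf (r : ℝ) :
      r4 < r ↔ (k + 2 * w) * (1 + b) * (1 - r) * tc / (2 * k) < 1 / 2 := by
    rw [div_lt_iff₀ hD, div_lt_iff₀ (by positivity)]
    constructor <;> intro h <;> linarith
  have hhalf' (r : ℝ) :
      r < r4 ↔ 1 / 2 < (k + 2 * w) * (1 + b) * (1 - r) * tc / (2 * k) := by
    rw [lt_div_iff₀ hD, lt_div_iff₀ (by positivity)]
    constructor <;> intro h <;> linarith
  have hpos {r : ℝ} (hr : r < 1)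
      (h : (k + 2 * w) * (1 + b) * (1 - r) * tc / (2 * k) < 1) :
      0 < (1 - (k + 2 * w) * (1 + b) * (1 - r) * tc / (2 * k)) *
        ((1 + b) * (1 - r) * tc) :=
    mul_pos (sub_pos.2 h) (mul_pos (mul_pos hb1 (sub_pos.2 hr)) htc)
  refine ⟨?_, fun hr => ⟨fun x _ => hPu_le x, fun x _ hx => ?_, hxu_lt hr⟩,
    fun r _ s _ hrs => hxu_anti hrs, fun r hr s hs hrs => ?_, fun r hr s hs hrs => ?_⟩
  · rw [hsup, gt_iff_lt, gt_iff_lt]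
    constructor
    · contrapose!
      intro hr
      have hA : 1 ≤ (1 + b) * (1 - ru) := not_lt.1 fun h => hr.not_gt ((hthreshold ru).2 h)
      refine csSup_le ⟨Pu x0, Set.mem_image_of_mem _ hx0_mem⟩ ?_
      rintro _ ⟨x, hx, rfl⟩
      have h : Pu x - P0 x ≤ 0 := by
        rw [hdiff]
        exact mul_nonpos_of_nonneg_of_nonpos
          (mul_nonneg (by positivity) (sub_nonneg.2 hx.2)) (sub_nonpos.2 hA)
      linarith [hP0_le x]
    · intro hr
      have h : 0 < Pu x0 - P0 x0 := by
        rw [hdiff]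
        exact mul_pos (mul_pos (by positivity) (sub_pos.2 hx1))
          (sub_pos.2 ((hthreshold ru).1 hr))
      have hle : Pu x0 ≤ sSup (Pu '' Set.Icc 0 1) := by
        refine le_csSup ⟨Pu xu, ?_⟩ (Set.mem_image_of_mem _ hx0_mem)
        rintro _ ⟨x, -, rfl⟩
        exact hPu_le x
      linarith
  · have h : k / 2 * (x - xu) ^ 2 = 0 := by linarith [hPu x]
    have h2 : (x - xu) ^ 2 = 0 := (mul_eq_zero.1 h).resolve_left (by positivity)
    exact sub_eq_zero.1 (pow_eq_zero_iff two_ne_zero |>.1 h2)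
  · refine one_div_lt_one_div_of_lt
      (hpos (hr.2.trans hr4_lt) ((hxu_lt hr.1).trans hx1)) ?_
    have h1 := (hhalf' r).1 hr.2
    have h2 := (hhalf' s).1 hs.2
    rw [hxu] at h1 h2 ⊢
    rw [hxu]
    exact mul_one_sub_mul_lt_of_lt_add (hcost hrs) (by linarith)
  · have h1 := (hhalf r).1 hr.1
    have h2 := (hhalf s).1 hs.1
    refine one_div_lt_one_div_of_lt (hpos hs.2 (by linarith)) ?_
    rw [hxu] at h1 h2 ⊢
    rw [hxu]
    exact mul_one_sub_mul_lt_of_add_lt (hcost hrs) (by linarith)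
end
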